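/- Let ε ∈ ℂ be a primitive 10th root of unity. The stabilizer Stab(x⁵+y⁵) ⊂ SL(2,ℂ) equals the subgroup generated by diag(ε, ε⁻¹) and [[0,i],[i,0]] (the binary dihedral group D₅, of order 20). -/

import Mathlib

open MvPolynomial Matrix

noncomputable section

/-- Polynomials in two variables `x = X 0`, `y = X 1` over `ℂ`. -/
abbrev BPoly : Type := MvPolynomial (Fin 2) ℂ

/-- The variable `x`. -/
def Px : BPoly := X 0

/-- The variable `y`. -/
def Py : BPoly := X 1

/-- Substitution action of a 2×2 matrix on polynomials in two variables:
for `A = [[p,q],[r,s]]`, `(f·A)(x,y) = f(px+qy, rx+sy)`. -/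
def matAct (A : Matrix (Fin 2) (Fin 2) ℂ) (f : BPoly) : BPoly :=
  bind₁ (fun i => C (A i 0) * Px + C (A i 1) * Py) f

/-- `f` is semi-invariant under `A`: `f·A = c·f` for some nonzero scalar `c`. -/
def SemiInv (A : Matrix (Fin 2) (Fin 2) ℂ) (f : BPoly) : Prop :=
  ∃ c : ℂ, c ≠ 0 ∧ matAct A f = C c * f

/-- The stabilizer of `f` inside `SL(2,ℂ)`: all matrices under which `f` is
semi-invariant. -/
def Stab (f : BPoly) : Set (SpecialLinearGroup (Fin 2) ℂ) :=
  {A | SemiInv (A : Matrix (Fin 2) (Fin 2) ℂ) f}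

/-- `f` is a (nonzero) binary form: nonzero and homogeneous of some degree. -/
def IsBinaryForm (f : BPoly) : Prop :=
  f ≠ 0 ∧ ∃ d : ℕ, f.IsHomogeneous d

/-- `f` is `SL(2,ℂ)`-equivalent to `g` up to a nonzero scalar:
`c·(f·A) = g` for some `A ∈ SL(2,ℂ)` and `c ≠ 0`. -/
def EquivForm (f g : BPoly) : Prop :=
  ∃ A : SpecialLinearGroup (Fin 2) ℂ, ∃ c : ℂ, c ≠ 0 ∧
    C c * matAct (A : Matrix (Fin 2) (Fin 2) ℂ) f = g

theorem eval_matAct (A : Matrix (Fin 2) (Fin 2) ℂ) (f : BPoly) (v : Fin 2 → ℂ) :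
    eval v (matAct A f) = eval (A *ᵥ v) f := by
  have hv : (fun i => eval v (C (A i 0) * Px + C (A i 1) * Py)) = A *ᵥ v := by
    funext i
    simp [Px, Py, Matrix.mulVec, dotProduct, Fin.sum_univ_two]
  rw [← hv, matAct, ← coe_aeval_eq_eval, ← coe_aeval_eq_eval]
  exact aeval_bind₁ _ _ _

theorem matAct_mul (A B : Matrix (Fin 2) (Fin 2) ℂ) (f : BPoly) :
    matAct (A * B) f = matAct B (matAct A f) :=
  MvPolynomial.funext fun v => by simp only [eval_matAct, Matrix.mulVec_mulVec]

theorem matAct_one (f : BPoly) : matAct 1 f = f :=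
  MvPolynomial.funext fun v => by simp [eval_matAct]

theorem matAct_C_mul (A : Matrix (Fin 2) (Fin 2) ℂ) (c : ℂ) (f : BPoly) :
    matAct A (C c * f) = C c * matAct A f := by
  simp [matAct]

/-- The stabilizer of `f`, as a subgroup of `SL(2,ℂ)`. -/
def stabSubgroup (f : BPoly) : Subgroup (SpecialLinearGroup (Fin 2) ℂ) where
  carrier := Stab f
  one_mem' := ⟨1, one_ne_zero, by simp [matAct_one]⟩
  mul_mem' := by
    rintro A B ⟨a, ha, hA⟩ ⟨b, hb, hB⟩
    refine ⟨a * b, mul_ne_zero ha hb, ?_⟩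
    rw [Matrix.SpecialLinearGroup.coe_mul, matAct_mul, hA, matAct_C_mul, hB, C_mul, mul_assoc]
  inv_mem' := by
    rintro A ⟨a, ha, hA⟩
    refine ⟨a⁻¹, inv_ne_zero ha, ?_⟩
    have h : f = C a * matAct (A⁻¹ : SpecialLinearGroup (Fin 2) ℂ) f := by
      rw [← matAct_C_mul, ← hA, ← matAct_mul, ← Matrix.SpecialLinearGroup.coe_mul, mul_inv_cancel,
        Matrix.SpecialLinearGroup.coe_one, matAct_one]
    conv_rhs => rw [h]
    rw [← mul_assoc, ← C_mul, inv_mul_cancel₀ ha, C_1, one_mul]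

theorem matAct_fermat_iff (A : Matrix (Fin 2) (Fin 2) ℂ) (c : ℂ) :
    matAct A (Px ^ 5 + Py ^ 5) = C c * (Px ^ 5 + Py ^ 5) ↔
      ∀ x y : ℂ, (A 0 0 * x + A 0 1 * y) ^ 5 + (A 1 0 * x + A 1 1 * y) ^ 5 =
        c * (x ^ 5 + y ^ 5) := by
  constructor
  · intro h x y
    have := congrArg (eval ![x, y]) h
    rw [eval_matAct] at this
    simpa [Px, Py, Matrix.mulVec, dotProduct, Fin.sum_univ_two] using this
  · intro h
    refine MvPolynomial.funext fun v => ?_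
    rw [eval_matAct]
    simpa [Px, Py, Matrix.mulVec, dotProduct, Fin.sum_univ_two] using h (v 0) (v 1)

/-- A unimodular matrix preserving `x⁵+y⁵` up to scalar is diagonal or antidiagonal. -/
theorem diagonal_or_antidiagonal {p q r s c : ℂ} (hdet : p * s - q * r = 1)
    (h : ∀ x y : ℂ, (p * x + q * y) ^ 5 + (r * x + s * y) ^ 5 = c * (x ^ 5 + y ^ 5)) :
    (q = 0 ∧ r = 0 ∧ p * s = 1 ∧ p ^ 10 = 1) ∨
      (p = 0 ∧ s = 0 ∧ q * r = -1 ∧ q ^ 10 = -1) := by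
  have hx := h 1 0
  have hy := h 0 1
  have h₁ := h 1 1
  have h₂ := h 1 (-1)
  have h₃ := h 1 2
  have h₄ := h 1 (-2)
  have h41 : p ^ 4 * q + r ^ 4 * s = 0 := by
    linear_combination (2 / 15) * (h₁ - h₂) - (1 / 60) * (h₃ - h₄) + (4 / 5) * hy
  have h32 : p ^ 3 * q ^ 2 + r ^ 3 * s ^ 2 = 0 := by
    linear_combination (1 / 15) * (h₁ + h₂) - (1 / 240) * (h₃ + h₄) - (1 / 8) * hx
  have hrs : r ^ 3 * s = 0 := by
    linear_combination p * h32 - q * h41 - r ^ 3 * s * hdet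
  have hpq : p ^ 4 * q = 0 := by linear_combination h41 - r * hrs
  rcases mul_eq_zero.1 hpq with hp | hq
  · obtain rfl : p = 0 := by simpa using hp
    have hqr : q * r = -1 := by linear_combination -hdet
    have hr : r ≠ 0 := by rintro rfl; simp at hqr
    obtain rfl : s = 0 := by simpa [hr] using hrs
    refine Or.inr ⟨rfl, rfl, hqr, ?_⟩
    have hqr5 : q ^ 5 * r ^ 5 = -1 := by rw [← mul_pow, hqr]; norm_num
    linear_combination q ^ 5 * (hy - hx) + hqr5
  · subst hq
    have hps : p * s = 1 := by linear_combination hdet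
    have hs : s ≠ 0 := by rintro rfl; simp at hps
    obtain rfl : r = 0 := by simpa [hs] using hrs
    refine Or.inl ⟨rfl, rfl, hps, ?_⟩
    have hps5 : p ^ 5 * s ^ 5 = 1 := by rw [← mul_pow, hps]; norm_num
    linear_combination p ^ 5 * (hx - hy) + hps5

section Generators

variable {ε : ℂ} {D S : SpecialLinearGroup (Fin 2) ℂ}

theorem coe_pow_of_coe_eq_diag (hD : (D : Matrix (Fin 2) (Fin 2) ℂ) = !![ε, 0; 0, ε⁻¹]) (k : ℕ) :
    ((D ^ k : SpecialLinearGroup (Fin 2) ℂ) : Matrix (Fin 2) (Fin 2) ℂ) =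
      !![ε ^ k, 0; 0, (ε ^ k)⁻¹] := by
  induction k with
  | zero => simp [Matrix.one_fin_two]
  | succ k ih => rw [pow_succ, Matrix.SpecialLinearGroup.coe_mul, ih, hD]; simp [pow_succ, mul_comm]

theorem coe_pow_mul_of_coe_eq (hD : (D : Matrix (Fin 2) (Fin 2) ℂ) = !![ε, 0; 0, ε⁻¹])
    (hS : (S : Matrix (Fin 2) (Fin 2) ℂ) = !![0, Complex.I; Complex.I, 0]) (k : ℕ) :
    ((D ^ k * S : SpecialLinearGroup (Fin 2) ℂ) : Matrix (Fin 2) (Fin 2) ℂ) =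
      !![0, ε ^ k * Complex.I; (ε ^ k)⁻¹ * Complex.I, 0] := by
  rw [Matrix.SpecialLinearGroup.coe_mul, coe_pow_of_coe_eq_diag hD, hS]
  simp

theorem closure_le_stabSubgroup (hε : ε ^ 10 = 1)
    (hD : (D : Matrix (Fin 2) (Fin 2) ℂ) = !![ε, 0; 0, ε⁻¹])
    (hS : (S : Matrix (Fin 2) (Fin 2) ℂ) = !![0, Complex.I; Complex.I, 0]) :
    Subgroup.closure {D, S} ≤ stabSubgroup (Px ^ 5 + Py ^ 5) := by
  have hε0 : ε ≠ 0 := by rintro rfl; simp at hε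
  have hinv : ε⁻¹ ^ 5 = ε ^ 5 := by
    rw [inv_pow, inv_eq_iff_eq_inv, ← mul_eq_one_iff_eq_inv₀ (pow_ne_zero 5 hε0), ← hε]
    ring
  rw [Subgroup.closure_le]
  rintro A (rfl | rfl)
  · refine ⟨ε ^ 5, pow_ne_zero 5 hε0, (matAct_fermat_iff _ _).2 fun x y => ?_⟩
    simp only [hD, Matrix.of_apply, Matrix.cons_val', Matrix.cons_val_zero, Matrix.cons_val_one,
      Matrix.cons_val_fin_one]
    linear_combination y ^ 5 * hinv
  · refine ⟨Complex.I ^ 5, pow_ne_zero 5 Complex.I_ne_zero,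
      (matAct_fermat_iff _ _).2 fun x y => ?_⟩
    simp only [hS, Matrix.of_apply, Matrix.cons_val', Matrix.cons_val_zero, Matrix.cons_val_one,
      Matrix.cons_val_fin_one]
    ring

/-- The words `Dᵏ` and `DᵏS`, for `0 ≤ k < 10`. -/
def dihedralWord (D S : SpecialLinearGroup (Fin 2) ℂ) :
    Fin 10 ⊕ Fin 10 → SpecialLinearGroup (Fin 2) ℂ :=
  Sum.elim (fun k => D ^ (k : ℕ)) (fun k => D ^ (k : ℕ) * S)

theorem range_dihedralWord_subset_closure :
    Set.range (dihedralWord D S) ⊆ Subgroup.closure {D, S} := by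
  have hD : D ∈ Subgroup.closure {D, S} := Subgroup.subset_closure (by simp)
  have hS : S ∈ Subgroup.closure {D, S} := Subgroup.subset_closure (by simp)
  rintro _ ⟨k | k, rfl⟩
  · exact pow_mem hD _
  · exact mul_mem (pow_mem hD _) hS

theorem stab_subset_range_dihedralWord (hε : IsPrimitiveRoot ε 10)
    (hD : (D : Matrix (Fin 2) (Fin 2) ℂ) = !![ε, 0; 0, ε⁻¹])
    (hS : (S : Matrix (Fin 2) (Fin 2) ℂ) = !![0, Complex.I; Complex.I, 0]) :
    Stab (Px ^ 5 + Py ^ 5) ⊆ Set.range (dihedralWord D S) := by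
  rintro A ⟨c, -, hA⟩
  have hdet := A.det_coe
  rw [Matrix.det_fin_two] at hdet
  rcases diagonal_or_antidiagonal hdet ((matAct_fermat_iff _ _).1 hA) with
    ⟨hq, hr, hps, hp⟩ | ⟨hp, hs, hqr, hq⟩
  · obtain ⟨k, hk, hpk⟩ := hε.eq_pow_of_pow_eq_one hp
    refine ⟨Sum.inl ⟨k, hk⟩, Subtype.ext ?_⟩
    refine (coe_pow_of_coe_eq_diag hD k).trans ?_
    rw [Matrix.eta_fin_two A.1, hpk, hq, hr, eq_inv_of_mul_eq_one_right hps]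
  · have hI : (A 0 1 * -Complex.I) ^ 10 = 1 := by
      rw [mul_pow, hq, neg_pow, show (10 : ℕ) = 2 * 5 from rfl, pow_mul Complex.I, Complex.I_sq]
      norm_num
    obtain ⟨k, hk, hqk⟩ := hε.eq_pow_of_pow_eq_one hI
    have hq' : ε ^ k * Complex.I = A 0 1 := by
      rw [hqk]
      linear_combination -A 0 1 * Complex.I_sq
    have hr' : (ε ^ k)⁻¹ * Complex.I = A 1 0 := by
      rw [inv_mul_eq_iff_eq_mul₀ (pow_ne_zero k (hε.ne_zero (by norm_num))), hqk]
      linear_combination Complex.I * hqr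
    refine ⟨Sum.inr ⟨k, hk⟩, Subtype.ext ?_⟩
    refine (coe_pow_mul_of_coe_eq hD hS k).trans ?_
    rw [Matrix.eta_fin_two A.1, hq', hr', hp, hs]

theorem dihedralWord_injective (hε : IsPrimitiveRoot ε 10)
    (hD : (D : Matrix (Fin 2) (Fin 2) ℂ) = !![ε, 0; 0, ε⁻¹])
    (hS : (S : Matrix (Fin 2) (Fin 2) ℂ) = !![0, Complex.I; Complex.I, 0]) :
    Function.Injective (dihedralWord D S) := by
  have hpow : Function.Injective fun k : Fin 10 => D ^ (k : ℕ) := by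
    intro k l h
    have h00 := congrArg (fun A : SpecialLinearGroup (Fin 2) ℂ => A 0 0) h
    simp only [coe_pow_of_coe_eq_diag hD] at h00
    exact Fin.ext (hε.pow_inj k.2 l.2 (by simpa using h00))
  refine hpow.sumElim ((mul_left_injective S).comp hpow) fun k l h => ?_
  have h00 := congrArg (fun A : SpecialLinearGroup (Fin 2) ℂ => A 0 0) h
  simp only [coe_pow_of_coe_eq_diag hD, coe_pow_mul_of_coe_eq hD hS] at h00
  exact pow_ne_zero k (hε.ne_zero (by norm_num)) (by simpa using h00)

end Generators

/-- The stabilizer of `x⁵+y⁵` in `SL(2,ℂ)` is the binary dihedral group `D₅` of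
order 20, generated by `diag(ε, ε⁻¹)` (`ε` a primitive 10th root of unity) and
`[[0,i],[i,0]]`. -/
theorem stab_quintic_fermat
    (ε : ℂ) (hε : IsPrimitiveRoot ε 10)
    (D S : SpecialLinearGroup (Fin 2) ℂ)
    (hD : (D : Matrix (Fin 2) (Fin 2) ℂ) = !![ε, 0; 0, ε⁻¹])
    (hS : (S : Matrix (Fin 2) (Fin 2) ℂ) = !![0, Complex.I; Complex.I, 0]) :
    Stab (Px ^ 5 + Py ^ 5) = ↑(Subgroup.closure {D, S}) ∧
    Nat.card (Subgroup.closure {D, S} : Subgroup (SpecialLinearGroup (Fin 2) ℂ)) = 20 := by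
  have hrange := range_dihedralWord_subset_closure (D := D) (S := S)
  have hstab := stab_subset_range_dihedralWord hε hD hS
  have hclosure : (Subgroup.closure {D, S} : Set (SpecialLinearGroup (Fin 2) ℂ)) ⊆
      Stab (Px ^ 5 + Py ^ 5) := closure_le_stabSubgroup hε.pow_eq_one hD hS
  refine ⟨(hstab.trans hrange).antisymm hclosure, ?_⟩
  rw [← SetLike.coe_sort_coe, (hclosure.trans hstab).antisymm hrange,
    Nat.card_range_of_injective (dihedralWord_injective hε hD hS)]
  simp

end
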